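/- arXiv:1501.00930 — 7 statements merged into one kernel-verified Lean document; each statement's English description precedes it below -/
import Mathlib

section
/- Let k ≥ 2, q ∈ ℂ with q ≠ 0, and s₂,…,s_{2k−1} ∈ ℂ. For even i let Sᵢ = [[1,0],[sᵢ,1]] and for odd i let Sᵢ = [[1,sᵢ],[0,1]]. Then there exist s₁, s_{2k} ∈ ℂ such that, with S₁ = [[1,s₁],[0,1]] and S_{2k} = [[1,0],[s_{2k},1]], the product S_{2k}·S_{2k−1}⋯S₂·S₁ equals diag(q⁻¹, q), if and only if the continuant satisfies K(s₂,s₃,…,s_{2k−1}) = 1/q; moreover when this holds the pair (s₁, s_{2k}) is unique. -/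
/-- Euler's continuant: `K [] = 1`, `K [x] = x`,
`K (x :: y :: t) = x * K (y :: t) + K t`. -/
def continuant : List ℂ → ℂ
  | [] => 1
  | [x] => x
  | x :: y :: t => x * continuant (y :: t) + continuant t

/-- `Sᵢ`: lower unitriangular `[[1,0],[sᵢ,1]]` for even `i`, upper
unitriangular `[[1,sᵢ],[0,1]]` for odd `i`. -/
noncomputable def Smat (s : ℕ → ℂ) (i : ℕ) : Matrix (Fin 2) (Fin 2) ℂ :=
  if Even i then !![1, 0; s i, 1] else !![1, s i; 0, 1]

/-- The product `S_{2k−1}·S_{2k−2}⋯S₃·S₂` of the middle matrices. -/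
noncomputable def midProd (k : ℕ) (s : ℕ → ℂ) : Matrix (Fin 2) (Fin 2) ℂ :=
  (List.ofFn (fun j : Fin (2 * k - 2) => Smat s (2 * k - 1 - (j : ℕ)))).prod

noncomputable def QQ (s : ℕ → ℂ) (m N : ℕ) : Matrix (Fin 2) (Fin 2) ℂ :=
  (List.ofFn (fun j : Fin N => Smat s (m + N - 1 - (j : ℕ)))).prod

def KL (s : ℕ → ℂ) (m N : ℕ) : List ℂ := List.ofFn (fun j : Fin N => s ((j : ℕ) + m))

def KT : List ℂ → ℂ
  | [] => 0
  | _ :: t => continuant t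

theorem continuant_cons (x : ℂ) (l : List ℂ) :
    continuant (x :: l) = x * continuant l + KT l := by
  cases l <;> simp [continuant, KT]

theorem KL_succ (s : ℕ → ℂ) (m N : ℕ) : KL s m (N + 1) = s m :: KL s (m + 1) N := by
  unfold KL
  rw [List.ofFn_succ]
  congr 2
  · simp
  · funext j
    congr 1
    simp
    omega

theorem QQ_succ (s : ℕ → ℂ) (m N : ℕ) : QQ s m (N + 1) = QQ s (m + 1) N * Smat s m := by
  unfold QQ
  rw [List.ofFn_succ', List.concat_eq_append, List.prod_append, List.prod_singleton]
  congr 1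
  · congr 2
    funext j
    congr 1
    simp
  · congr 1
    simp

theorem Smat_det (s : ℕ → ℂ) (m : ℕ) : (Smat s m).det = 1 := by
  unfold Smat
  split_ifs <;> simp [Matrix.det_fin_two]

theorem QQ_det (s : ℕ → ℂ) (N : ℕ) : ∀ m, (QQ s m N).det = 1 := by
  induction N with
  | zero => intro m; simp [QQ]
  | succ n ih => intro m; rw [QQ_succ, Matrix.det_mul, ih, Smat_det, one_mul]

theorem QQ_row (s : ℕ → ℂ) (n : ℕ) : ∀ m, Even m →
    QQ s m (2 * n) 0 0 = continuant (KL s m (2 * n)) ∧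
    QQ s m (2 * n) 0 1 = KT (KL s m (2 * n)) := by
  induction n with
  | zero => intro m _; simp [QQ, KL, KT, continuant]
  | succ n ih =>
    intro m hm
    obtain ⟨h1, h2⟩ := ih (m + 2) (by simpa [Nat.even_add] using hm)
    have ho : ¬ Even (m + 1) := by simpa [Nat.even_add_one] using hm
    rw [show 2 * (n + 1) = 2 * n + 1 + 1 by ring, QQ_succ, QQ_succ, KL_succ, KL_succ]
    simp only [KT, continuant_cons, Smat, if_pos hm, if_neg ho, Matrix.mul_apply,
      Fin.sum_univ_two, show m + 1 + 1 = m + 2 by rfl, h1, h2]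
    constructor
    · simp
      ring
    · simp
      ring

theorem closure_aux (M : Matrix (Fin 2) (Fin 2) ℂ) (a b q : ℂ) :
    !![1, 0; b, 1] * M * !![1, a; 0, 1] = !![q⁻¹, 0; 0, q] ↔
      M 0 0 = q⁻¹ ∧ M 0 0 * a + M 0 1 = 0 ∧ b * M 0 0 + M 1 0 = 0 ∧
        (b * M 0 0 + M 1 0) * a + (b * M 0 1 + M 1 1) = q := by
  rw [← Matrix.ext_iff]
  simp [Fin.forall_fin_two, Matrix.mul_apply, Fin.sum_univ_two, and_assoc, Matrix.vecMul, dotProduct]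

/-- there exist `s₁, s_{2k}` with
`S_{2k}·S_{2k−1}⋯S₂·S₁ = diag(q⁻¹, q)` iff `K(s₂,…,s_{2k−1}) = 1/q`;
moreover such a pair `(s₁, s_{2k})` is unique. -/
theorem exists_eulerian_closure_iff_continuant (k : ℕ) (hk : 2 ≤ k) (q : ℂ)
    (hq : q ≠ 0) (s : ℕ → ℂ) :
    ((∃ s1 s2k : ℂ,
        !![1, 0; s2k, 1] * midProd k s * !![1, s1; 0, 1] = !![q⁻¹, 0; 0, q]) ↔
      continuant (List.ofFn (fun j : Fin (2 * k - 2) => s ((j : ℕ) + 2))) = 1 / q) ∧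
    (∀ s1 s2k s1' s2k' : ℂ,
      !![1, 0; s2k, 1] * midProd k s * !![1, s1; 0, 1] = !![q⁻¹, 0; 0, q] →
      !![1, 0; s2k', 1] * midProd k s * !![1, s1'; 0, 1] = !![q⁻¹, 0; 0, q] →
      s1 = s1' ∧ s2k = s2k') := by
  have hM : midProd k s = QQ s 2 (2 * (k - 1)) := by
    unfold midProd QQ
    rw [show 2 * (k - 1) = 2 * k - 2 by omega]
    congr 2
    funext j
    congr 1
    omega
  have hK : List.ofFn (fun j : Fin (2 * k - 2) => s ((j : ℕ) + 2)) = KL s 2 (2 * (k - 1)) := by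
    rw [show 2 * (k - 1) = 2 * k - 2 by omega]
    rfl
  have h00 := (QQ_row s (k - 1) 2 (by decide)).1
  have hdet := QQ_det s (2 * (k - 1)) 2
  rw [hK, ← h00, hM, one_div]
  generalize QQ s 2 (2 * (k - 1)) = M at *
  rw [Matrix.det_fin_two] at hdet
  have hqi : q⁻¹ ≠ 0 := inv_ne_zero hq
  simp only [closure_aux]
  refine ⟨⟨fun ⟨_, _, h, _⟩ => h, fun h => ?_⟩, ?_⟩
  · refine ⟨-q * M 0 1, -q * M 1 0, h, ?_, ?_, ?_⟩
    · rw [h]; field_simp; ring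
    · rw [h]; field_simp; ring
    · rw [h] at hdet ⊢
      field_simp at hdet ⊢
      linear_combination hdet
  · rintro a b a' b' ⟨h, h1, h2, -⟩ ⟨-, h1', h2', -⟩
    rw [h] at h1 h2 h1' h2'
    constructor
    · apply mul_left_cancel₀ hqi
      linear_combination h1 - h1'
    · apply mul_right_cancel₀ hqi
      linear_combination h2 - h2'
end

section
/- Let m ≥ 1, x₁,…,x_{2m} ∈ ℂ, and λ ∈ ℂ with λ ≠ 0. Then K(λx₁, λ⁻¹x₂, λx₃, λ⁻¹x₄, …, λx_{2m−1}, λ⁻¹x_{2m}) = K(x₁,…,x_{2m}); that is, the even-length continuant is invariant under the alternating scaling action of ℂ*. (This is the invariance of the group-valued moment map for the ℂ* action.) -/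
noncomputable def altScale : ℂ → List ℂ → List ℂ
  | _, [] => []
  | l, x :: t => (l * x) :: altScale l⁻¹ t

theorem altScale_ofFn (n : ℕ) : ∀ (x : Fin n → ℂ) (l : ℂ),
    List.ofFn (fun i : Fin n => (if Even (i : ℕ) then l else l⁻¹) * x i)
      = altScale l (List.ofFn x) := by
  induction n with
  | zero => intro x l; simp [altScale]
  | succ n ih =>
    intro x l
    rw [List.ofFn_succ, List.ofFn_succ, altScale, ← ih]
    congr 1
    congr 1
    funext i
    by_cases h : Even (i : ℕ) <;> simp [Nat.even_add_one, h]

theorem continuant_altScale : ∀ (L : List ℂ) (l : ℂ), l ≠ 0 →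
    continuant (altScale l L) = (if Even L.length then 1 else l) * continuant L
  | [], l, _ => by simp [altScale, continuant]
  | [x], l, _ => by simp [altScale, continuant]
  | x :: y :: t, l, hl => by
    have h1 := continuant_altScale (y :: t) l⁻¹ (inv_ne_zero hl)
    have h2 := continuant_altScale t l hl
    simp only [altScale, inv_inv] at h1 ⊢
    rw [continuant, h1, h2, continuant]
    by_cases h : Even t.length
    · simp [Nat.even_add_one, h]
      field_simp
    · simp [Nat.even_add_one, h]
      ring

/-- the even-length continuant is invariant under the alternating
scaling action of `ℂ*`:
`K(λx₁, λ⁻¹x₂, …, λx_{2m−1}, λ⁻¹x_{2m}) = K(x₁,…,x_{2m})`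
(here `x₁` corresponds to the index `0`, which is even). -/
theorem continuant_alternating_scaling_invariant (m : ℕ) (hm : 1 ≤ m)
    (x : Fin (2 * m) → ℂ) (l : ℂ) (hl : l ≠ 0) :
    continuant
        (List.ofFn (fun i : Fin (2 * m) =>
          (if Even (i : ℕ) then l else l⁻¹) * x i)) =
      continuant (List.ofFn x) := by
  rw [altScale_ofFn, continuant_altScale _ _ hl]
  simp
end

section
/- Let n ≥ 2. Let V = { v : ZMod n → ℂ² : det(vᵢ, vᵢ₊₁) ≠ 0 for all i }, let W = { [[a,1],[b,0]] : a ∈ ℂ, b ∈ ℂ, b ≠ 0 } ⊂ GL₂(ℂ), and let 𝒲 = { (B₁,…,Bₙ) ∈ Wⁿ : Bₙ⋯B₂·B₁ = 1 }. Then the map V → GL₂(ℂ) × 𝒲 sending v to (Ψ₁, (B₁,…,Bₙ)), where Ψᵢ = (vᵢ vᵢ₊₁) and Bᵢ = Ψᵢ⁻¹Ψᵢ₋₁, is a bijection; in particular the diagonal action of GL₂(ℂ) on V is free with quotient 𝒲, and Ψᵢ = Ψ₁·B₁·Bₙ·B_{n−1}⋯B_{i+1} for all i. -/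
/-- `Ψᵢ`: the `2×2` matrix with columns `vᵢ` and `vᵢ₊₁`. -/
def Psi (n : ℕ) (v : ZMod n → Fin 2 → ℂ) (i : ZMod n) : Matrix (Fin 2) (Fin 2) ℂ :=
  !![v i 0, v (i + 1) 0; v i 1, v (i + 1) 1]

/-- `Bᵢ = Ψᵢ⁻¹·Ψᵢ₋₁`, the Stokes matrices of Sibuya. -/
noncomputable def Bmat (n : ℕ) (v : ZMod n → Fin 2 → ℂ) (i : ZMod n) :
    Matrix (Fin 2) (Fin 2) ℂ :=
  (Psi n v i)⁻¹ * Psi n v (i - 1)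

/-- The set `W = {[[a,1],[b,0]] : a, b ∈ ℂ, b ≠ 0} ⊂ GL₂(ℂ)`. -/
def Wset : Set (Matrix (Fin 2) (Fin 2) ℂ) :=
  {M | M 0 1 = 1 ∧ M 1 1 = 0 ∧ M 1 0 ≠ 0}

theorem aux_prod (f : ℕ → Matrix (Fin 2) (Fin 2) ℂ) (k : ℕ) :
    (List.ofFn (fun j : Fin (k+1) => f j)).prod
      = (List.ofFn (fun j : Fin k => f j)).prod * f k := by
  rw [List.ofFn_succ']
  simp [List.concat_eq_append]

theorem aux_step (n : ℕ) (v : ZMod n → Fin 2 → ℂ) (hv : ∀ i : ZMod n, (Psi n v i).det ≠ 0)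
    (i : ZMod n) : Psi n v (i - 1) = Psi n v i * Bmat n v i := by
  unfold Bmat
  rw [← mul_assoc, Matrix.mul_nonsing_inv _ (isUnit_iff_ne_zero.mpr (hv i)), one_mul]

theorem aux_neg (n : ℕ) (v : ZMod n → Fin 2 → ℂ) (hv : ∀ i : ZMod n, (Psi n v i).det ≠ 0)
    (k : ℕ) : Psi n v (-(k : ZMod n)) = Psi n v 1 * Bmat n v 1 *
      (List.ofFn (fun j : Fin k => Bmat n v (-((j : ℕ) : ZMod n)))).prod := by
  induction k with
  | zero =>
    have := aux_step n v hv 1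
    simpa using this
  | succ k ih =>
    rw [aux_prod (fun j => Bmat n v (-((j : ℕ) : ZMod n))), ← mul_assoc, ← ih, ← aux_step n v hv]
    congr 1
    push_cast
    ring

theorem aux_cancel (A B C : Matrix (Fin 2) (Fin 2) ℂ) (h : C.det ≠ 0) (e : A * C = B * C) :
    A = B := by
  have hu : IsUnit C.det := isUnit_iff_ne_zero.mpr h
  have := congrArg (fun M => M * C⁻¹) e
  simpa [mul_assoc, Matrix.mul_nonsing_inv _ hu] using this

theorem aux_cancel_left (A B C : Matrix (Fin 2) (Fin 2) ℂ) (h : C.det ≠ 0) (e : C * A = C * B) :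
    A = B := by
  have hu : IsUnit C.det := isUnit_iff_ne_zero.mpr h
  have := congrArg (fun M => C⁻¹ * M) e
  simpa [← mul_assoc, Matrix.nonsing_inv_mul _ hu] using this

theorem aux_W (M : Matrix (Fin 2) (Fin 2) ℂ) (h : M ∈ Wset) : M.det ≠ 0 := by
  obtain ⟨h1, h2, h3⟩ := h
  rw [Matrix.det_fin_two, h1, h2]
  simpa using h3

theorem aux_memW (n : ℕ) (v : ZMod n → Fin 2 → ℂ) (hv : ∀ i : ZMod n, (Psi n v i).det ≠ 0)
    (i : ZMod n) : Bmat n v i ∈ Wset := by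
  have e := aux_step n v hv i
  have hd := hv i
  have hd' := hv (i - 1)
  have e2 : (Psi n v i).mulVec (fun r => Bmat n v i r 1) = (Psi n v i).mulVec ![1, 0] := by
    ext r
    have := congrFun (congrFun e r) 1
    rw [Matrix.mul_apply] at this
    rw [Matrix.mulVec, dotProduct, ← this]
    fin_cases r <;> simp [Psi, Matrix.mulVec, dotProduct]
  have e3 := Matrix.mulVec_injective_iff_isUnit.mpr
    ((Matrix.isUnit_iff_isUnit_det _).mpr (isUnit_iff_ne_zero.mpr hd)) e2
  have h0 : Bmat n v i 0 1 = 1 := by simpa using congrFun e3 0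
  have h1 : Bmat n v i 1 1 = 0 := by simpa using congrFun e3 1
  refine ⟨h0, h1, ?_⟩
  intro h2
  apply hd'
  rw [e, Matrix.det_mul, Matrix.det_fin_two (Bmat n v i), h1, h2]
  simp

theorem aux_surj (n : ℕ) (hn : 2 ≤ n) (C : Matrix (Fin 2) (Fin 2) ℂ)
    (B : ZMod n → Matrix (Fin 2) (Fin 2) ℂ) (hC : C.det ≠ 0) (hB : ∀ i, B i ∈ Wset)
    (hp : (List.ofFn (fun j : Fin n => B (-((j : ℕ) : ZMod n)))).prod = 1) :
    ∃ v : ZMod n → Fin 2 → ℂ, (∀ i, (Psi n v i).det ≠ 0) ∧ Psi n v 1 = C ∧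
      ∀ i, Bmat n v i = B i := by
  have : NeZero n := ⟨by omega⟩
  have : Fact (1 < n) := ⟨by omega⟩
  obtain ⟨P, hP⟩ : ∃ P : ℕ → Matrix (Fin 2) (Fin 2) ℂ, P = fun k => C * B 1 *
    (List.ofFn (fun j : Fin k => B (-((j : ℕ) : ZMod n)))).prod := ⟨_, rfl⟩
  have P0 : P 0 = C * B 1 := by simp [hP]
  have Pn : P n = P 0 := by rw [P0, hP]; simp only [hp, mul_one]
  have Ps : ∀ k : ℕ, P (k+1) = P k * B (-(k : ZMod n)) := by
    intro k
    simp only [hP]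
    rw [aux_prod (fun j => B (-((j : ℕ) : ZMod n))), ← mul_assoc]
  have Pd : ∀ k, (P k).det ≠ 0 := by
    intro k
    induction k with
    | zero => rw [P0, Matrix.det_mul]; exact mul_ne_zero hC (aux_W _ (hB 1))
    | succ k ih => rw [Ps, Matrix.det_mul]; exact mul_ne_zero ih (aux_W _ (hB _))
  obtain ⟨Q, hQ⟩ : ∃ Q : ZMod n → Matrix (Fin 2) (Fin 2) ℂ, Q = fun i => P (-i).val := ⟨_, rfl⟩
  have Qs : ∀ i, Q (i - 1) = Q i * B i := by
    intro i
    have h1 := Ps (-i).val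
    rw [ZMod.natCast_zmod_val, neg_neg] at h1
    simp only [hQ]
    rw [← h1]
    have h2 : -(i - 1) = -i + 1 := by ring
    rw [h2, ZMod.val_add, ZMod.val_one]
    have h3 := ZMod.val_lt (-i)
    rcases Nat.lt_or_ge ((-i).val + 1) n with h | h
    · rw [Nat.mod_eq_of_lt h]
    · have h4 : (-i).val + 1 = n := by omega
      rw [h4, Nat.mod_self, Pn]
  have Qd : ∀ i, (Q i).det ≠ 0 := by intro i; rw [hQ]; exact Pd _
  have Qc : ∀ i r, Q i r 1 = Q (i+1) r 0 := by
    intro i r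
    have h := Qs (i+1)
    rw [add_sub_cancel_right] at h
    rw [h, Matrix.mul_apply]
    obtain ⟨h1, h2, -⟩ := hB (i+1)
    simp [Fin.sum_univ_two, h1, h2]
  have hPsi : ∀ i, Psi n (fun i r => Q i r 0) i = Q i := by
    intro i
    ext r c
    fin_cases r <;> fin_cases c <;> simp [Psi, Qc]
  refine ⟨fun i r => Q i r 0, fun i => by rw [hPsi]; exact Qd i, ?_, ?_⟩
  · rw [hPsi]
    apply aux_cancel _ _ (B 1) (aux_W _ (hB 1))
    rw [← Qs, ← P0, hQ]
    simp
  · intro i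
    unfold Bmat
    rw [hPsi, hPsi, Qs, ← mul_assoc,
      Matrix.nonsing_inv_mul _ (isUnit_iff_ne_zero.mpr (Qd i)), one_mul]

/-- the map `v ↦ (Ψ₁, (B₁,…,Bₙ))` is a bijection from
`V = {v : det(vᵢ,vᵢ₊₁) ≠ 0 ∀i}` onto `GL₂(ℂ) × 𝒲`, where
`𝒲 = {(B₁,…,Bₙ) ∈ Wⁿ : Bₙ⋯B₂B₁ = 1}`; in particular the diagonal
`GL₂(ℂ)`-action on `V` is free (with quotient `𝒲`), and
`Ψᵢ = Ψ₁·B₁·Bₙ·B_{n−1}⋯B_{i+1}` for all `i = 1, …, n`. -/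
theorem sibuya_trivial_bundle (n : ℕ) (hn : 2 ≤ n) :
    Set.BijOn
      (fun v : ZMod n → Fin 2 → ℂ => (Psi n v 1, fun i : ZMod n => Bmat n v i))
      {v | ∀ i : ZMod n, (Psi n v i).det ≠ 0}
      {CB : Matrix (Fin 2) (Fin 2) ℂ × (ZMod n → Matrix (Fin 2) (Fin 2) ℂ) |
        CB.1.det ≠ 0 ∧ (∀ i : ZMod n, CB.2 i ∈ Wset) ∧
        (List.ofFn (fun j : Fin n => CB.2 (-((j : ℕ) : ZMod n)))).prod = 1} ∧
    (∀ g : Matrix (Fin 2) (Fin 2) ℂ, g.det ≠ 0 →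
      ∀ v : ZMod n → Fin 2 → ℂ, (∀ i : ZMod n, (Psi n v i).det ≠ 0) →
        (∀ i : ZMod n, g.mulVec (v i) = v i) → g = 1) ∧
    (∀ v : ZMod n → Fin 2 → ℂ, (∀ i : ZMod n, (Psi n v i).det ≠ 0) →
      ∀ i : ℕ, 1 ≤ i → i ≤ n →
        Psi n v ((i : ℕ) : ZMod n) =
          Psi n v 1 * Bmat n v 1 *
            (List.ofFn (fun j : Fin (n - i) => Bmat n v (-((j : ℕ) : ZMod n)))).prod) := by
  have : NeZero n := ⟨by omega⟩
  refine ⟨⟨?_, ?_, ?_⟩, ?_, ?_⟩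
  · intro v hv
    refine ⟨hv 1, fun i => aux_memW n v hv i, ?_⟩
    have h := aux_neg n v hv n
    have h0 := aux_neg n v hv 0
    have hc : (-((n : ℕ) : ZMod n)) = -((0 : ℕ) : ZMod n) := by simp
    rw [hc, h0] at h
    have hd := hv (-((0 : ℕ) : ZMod n))
    rw [h0] at hd
    simp only [List.ofFn_zero, List.prod_nil, mul_one] at h hd
    symm
    apply aux_cancel_left _ _ _ hd
    rw [mul_one]
    exact h
  · intro v hv w hw h
    have h1 : Psi n v 1 = Psi n w 1 := congrArg Prod.fst h
    have h2 : ∀ i, Bmat n v i = Bmat n w i := fun i => congrFun (congrArg Prod.snd h) i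
    have key : ∀ i, Psi n v i = Psi n w i := by
      intro i
      have e1 := aux_neg n v hv (-i).val
      have e2 := aux_neg n w hw (-i).val
      rw [ZMod.natCast_zmod_val, neg_neg] at e1 e2
      rw [e1, e2, h1]
      simp only [h2]
    funext i r
    have := congrFun (congrFun (key i) r) 0
    fin_cases r <;> simpa [Psi] using this
  · rintro ⟨C, B⟩ ⟨hC, hB, hp⟩
    obtain ⟨v, hv, h1, h2⟩ := aux_surj n hn C B hC hB hp
    exact ⟨v, hv, Prod.ext h1 (funext h2)⟩
  · intro g _ v hv h
    apply aux_cancel _ _ (Psi n v 1) (hv 1)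
    rw [one_mul]
    ext r c
    have a := congrFun (h 1) r
    have b := congrFun (h (1+1)) r
    simp only [Matrix.mulVec, dotProduct, Fin.sum_univ_two] at a b
    fin_cases r <;> fin_cases c <;>
      simp [Psi, Matrix.mul_apply, Fin.sum_univ_two] <;> first | exact a | exact b
  · intro v hv i _ hi
    rw [← aux_neg n v hv (n - i)]
    congr 1
    rw [Nat.cast_sub hi]
    simp
end

section
/- Let k ≥ 1, let a : ZMod (2k) → ℂ with aᵢ ≠ 0 for all i, and let p : ZMod (2k) → ℂ with pᵢ ≠ pᵢ₊₁ for all i. Set vᵢ = (aᵢ, aᵢ·pᵢ) ∈ ℂ² and d(i,j) = det(vᵢ vⱼ) (the determinant of the 2×2 matrix with columns vᵢ and vⱼ). Then, with indices modulo 2k, (∏_{i=1}^{k} d(2i−1, 2i)) / (∏_{i=1}^{k} d(2i+1, 2i)) = (−1)^k · (∏_{i=1}^{k} (p_{2i−1} − p_{2i})) / (∏_{i=1}^{k} (p_{2i} − p_{2i+1})) = φ(p₁,…,p_{2k}); i.e. the formal monodromy equals the multiratio of the corresponding points of ℙ¹. -/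
/-- The multiratio `φ(p₁,…,p_{2k}) = (−1)^k ((p₁−p₂)(p₃−p₄)⋯(p_{2k−1}−p_{2k}))
/ ((p₂−p₃)(p₄−p₅)⋯(p_{2k}−p₁))` of a cyclic `2k`-tuple of points of `ℂ`,
indexed here by `ZMod (2k)` with `pⱼ` corresponding to the index `j` (so the
index `0` corresponds to `p_{2k}`). -/
noncomputable def multiratio (k : ℕ) (p : ZMod (2 * k) → ℂ) : ℂ :=
  (-1) ^ k *
      (∏ i ∈ Finset.range k,
        (p ((2 * i + 1 : ℕ) : ZMod (2 * k)) - p ((2 * i + 2 : ℕ) : ZMod (2 * k)))) /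
    (∏ i ∈ Finset.range k,
      (p ((2 * i + 2 : ℕ) : ZMod (2 * k)) - p ((2 * i + 3 : ℕ) : ZMod (2 * k))))

/-- with `vᵢ = (aᵢ, aᵢpᵢ)` (for `aᵢ ≠ 0`) and
`d(i,j) = det(vᵢ vⱼ)`, the formal monodromy
`(∏ᵢ₌₁ᵏ d(2i−1,2i)) / (∏ᵢ₌₁ᵏ d(2i+1,2i))` equals
`(−1)^k (∏ᵢ₌₁ᵏ (p_{2i−1} − p_{2i})) / (∏ᵢ₌₁ᵏ (p_{2i} − p_{2i+1}))`,
which is the multiratio `φ(p₁,…,p_{2k})`, all indices taken modulo `2k`. -/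
theorem formal_monodromy_eq_multiratio (k : ℕ) (hk : 1 ≤ k)
    (a p : ZMod (2 * k) → ℂ) (ha : ∀ i, a i ≠ 0)
    (hp : ∀ i : ZMod (2 * k), p i ≠ p (i + 1))
    (v : ZMod (2 * k) → Fin 2 → ℂ) (hv : ∀ i, v i = ![a i, a i * p i])
    (d : ZMod (2 * k) → ZMod (2 * k) → ℂ)
    (hd : ∀ i j, d i j = (!![v i 0, v j 0; v i 1, v j 1]).det) :
    (∏ i ∈ Finset.range k,
        d ((2 * i + 1 : ℕ) : ZMod (2 * k)) ((2 * i + 2 : ℕ) : ZMod (2 * k))) /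
      (∏ i ∈ Finset.range k,
        d ((2 * i + 3 : ℕ) : ZMod (2 * k)) ((2 * i + 2 : ℕ) : ZMod (2 * k))) =
      (-1) ^ k *
          (∏ i ∈ Finset.range k,
            (p ((2 * i + 1 : ℕ) : ZMod (2 * k)) - p ((2 * i + 2 : ℕ) : ZMod (2 * k)))) /
        (∏ i ∈ Finset.range k,
          (p ((2 * i + 2 : ℕ) : ZMod (2 * k)) - p ((2 * i + 3 : ℕ) : ZMod (2 * k)))) ∧
    (-1) ^ k *
          (∏ i ∈ Finset.range k,
            (p ((2 * i + 1 : ℕ) : ZMod (2 * k)) - p ((2 * i + 2 : ℕ) : ZMod (2 * k)))) /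
        (∏ i ∈ Finset.range k,
          (p ((2 * i + 2 : ℕ) : ZMod (2 * k)) - p ((2 * i + 3 : ℕ) : ZMod (2 * k)))) =
      multiratio k p := by
  refine ⟨?_, rfl⟩
  have hdet : ∀ i j, d i j = a i * a j * (p j - p i) := by
    intro i j
    rw [hd, Matrix.det_fin_two_of, hv, hv]
    simp
    ring
  have hshift : (∏ i ∈ Finset.range k, a ((2 * i + 3 : ℕ) : ZMod (2 * k))) =
      ∏ i ∈ Finset.range k, a ((2 * i + 1 : ℕ) : ZMod (2 * k)) := by
    have h1 := Finset.prod_range_succ (fun i : ℕ => a ((2 * i + 1 : ℕ) : ZMod (2 * k))) k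
    have h2 := Finset.prod_range_succ' (fun i : ℕ => a ((2 * i + 1 : ℕ) : ZMod (2 * k))) k
    have h3 : ((2 * k + 1 : ℕ) : ZMod (2 * k)) = ((2 * 0 + 1 : ℕ) : ZMod (2 * k)) := by
      rw [Nat.cast_add, ZMod.natCast_self]
      simp
    rw [h1] at h2
    simp only [h3] at h2
    exact (mul_right_cancel₀ (ha _) h2).symm
  have hN : (∏ i ∈ Finset.range k,
        d ((2 * i + 1 : ℕ) : ZMod (2 * k)) ((2 * i + 2 : ℕ) : ZMod (2 * k))) =
      ((∏ i ∈ Finset.range k, a ((2 * i + 1 : ℕ) : ZMod (2 * k))) *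
        (∏ i ∈ Finset.range k, a ((2 * i + 2 : ℕ) : ZMod (2 * k)))) *
      ((-1) ^ k * ∏ i ∈ Finset.range k,
        (p ((2 * i + 1 : ℕ) : ZMod (2 * k)) - p ((2 * i + 2 : ℕ) : ZMod (2 * k)))) := by
    have hc : ((-1 : ℂ)) ^ k = ∏ _i ∈ Finset.range k, (-1 : ℂ) := by simp
    rw [hc, ← Finset.prod_mul_distrib, ← Finset.prod_mul_distrib, ← Finset.prod_mul_distrib]
    refine Finset.prod_congr rfl fun i _ => ?_
    rw [hdet]
    ring
  have hD : (∏ i ∈ Finset.range k,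
        d ((2 * i + 3 : ℕ) : ZMod (2 * k)) ((2 * i + 2 : ℕ) : ZMod (2 * k))) =
      ((∏ i ∈ Finset.range k, a ((2 * i + 1 : ℕ) : ZMod (2 * k))) *
        (∏ i ∈ Finset.range k, a ((2 * i + 2 : ℕ) : ZMod (2 * k)))) *
      (∏ i ∈ Finset.range k,
        (p ((2 * i + 2 : ℕ) : ZMod (2 * k)) - p ((2 * i + 3 : ℕ) : ZMod (2 * k)))) := by
    rw [← hshift, ← Finset.prod_mul_distrib, ← Finset.prod_mul_distrib]
    exact Finset.prod_congr rfl fun i _ => hdet _ _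
  rw [hN, hD]
  exact mul_div_mul_left _ _ (mul_ne_zero (Finset.prod_ne_zero_iff.mpr fun i _ => ha _)
    (Finset.prod_ne_zero_iff.mpr fun i _ => ha _))
end

section
/- Let q ∈ ℂ with q ≠ 0 and let s₁,…,s₆ ∈ ℂ. Set S₁ = [[1,s₁],[0,1]], S₃ = [[1,s₃],[0,1]], S₅ = [[1,s₅],[0,1]] and S₂ = [[1,0],[s₂,1]], S₄ = [[1,0],[s₄,1]], S₆ = [[1,0],[s₆,1]]. Then S₆·S₅·S₄·S₃·S₂·S₁ = diag(q⁻¹, q) if and only if the three equations hold: s₁ = −q(s₃s₄s₅ + s₃ + s₅), s₆ = −q(s₂s₃s₄ + s₂ + s₄), and s₂s₃s₄s₅ + s₂s₃ + s₂s₅ + s₄s₅ + 1 = 1/q. -/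
/-- for `q ≠ 0`, the equation `S₆·S₅·S₄·S₃·S₂·S₁ = diag(q⁻¹,q)`
(with `S₁,S₃,S₅` upper unitriangular and `S₂,S₄,S₆` lower unitriangular) is
equivalent to the three equations `s₁ = −q(s₃s₄s₅ + s₃ + s₅)`,
`s₆ = −q(s₂s₃s₄ + s₂ + s₄)` and
`s₂s₃s₄s₅ + s₂s₃ + s₂s₅ + s₄s₅ + 1 = 1/q`. -/
theorem k_eq_three_wild_character_variety_equations (q s1 s2 s3 s4 s5 s6 : ℂ)
    (hq : q ≠ 0) :
    !![1, 0; s6, 1] * !![1, s5; 0, 1] * !![1, 0; s4, 1] * !![1, s3; 0, 1] *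
        !![1, 0; s2, 1] * !![1, s1; 0, 1] = !![q⁻¹, 0; 0, q] ↔
      (s1 = -q * (s3 * s4 * s5 + s3 + s5) ∧
       s6 = -q * (s2 * s3 * s4 + s2 + s4) ∧
       s2 * s3 * s4 * s5 + s2 * s3 + s2 * s5 + s4 * s5 + 1 = 1 / q) := by
  have hp : q * q⁻¹ = 1 := mul_inv_cancel₀ hq
  rw [one_div]
  generalize q⁻¹ = p at hp ⊢
  have key : !![1, 0; s6, 1] * !![1, s5; 0, 1] * !![1, 0; s4, 1] * !![1, s3; 0, 1] *
        !![1, 0; s2, 1] * !![1, s1; 0, 1] = !![p, 0; 0, q] ↔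
      ((s2 * s3 * s4 * s5 + s2 * s3 + s2 * s5 + s4 * s5 + 1 = p ∧
        (s2 * s3 * s4 * s5 + s2 * s3 + s2 * s5 + s4 * s5 + 1) * s1
          + (s3 * s4 * s5 + s3 + s5) = 0) ∧
       (s6 * (s2 * s3 * s4 * s5 + s2 * s3 + s2 * s5 + s4 * s5 + 1)
          + (s2 * s3 * s4 + s2 + s4) = 0 ∧
        (s6 * (s2 * s3 * s4 * s5 + s2 * s3 + s2 * s5 + s4 * s5 + 1)
          + (s2 * s3 * s4 + s2 + s4)) * s1 + s6 * (s3 * s4 * s5 + s3 + s5)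
          + (s3 * s4 + 1) = q)) := by
    rw [← Matrix.ext_iff]
    simp only [Fin.forall_fin_two, Matrix.mul_fin_two, Matrix.of_apply, Matrix.cons_val',
      Matrix.cons_val_zero, Matrix.cons_val_one, Matrix.cons_val_fin_one]
    refine and_congr (and_congr ?_ ?_) (and_congr ?_ ?_) <;>
      refine Eq.congr ?_ rfl <;> ring
  rw [key]
  have hdet : (s2 * s3 * s4 * s5 + s2 * s3 + s2 * s5 + s4 * s5 + 1) * (s3 * s4 + 1)
      - (s3 * s4 * s5 + s3 + s5) * (s2 * s3 * s4 + s2 + s4) = 1 := by ring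
  generalize s2 * s3 * s4 * s5 + s2 * s3 + s2 * s5 + s4 * s5 + 1 = A at *
  generalize s3 * s4 * s5 + s3 + s5 = B at *
  generalize s2 * s3 * s4 + s2 + s4 = C at *
  generalize s3 * s4 + 1 = D at *
  constructor
  · rintro ⟨⟨rfl, h2⟩, h3, -⟩
    refine ⟨?_, ?_, rfl⟩
    · linear_combination q * h2 - s1 * hp
    · linear_combination q * h3 - s6 * hp
  · rintro ⟨rfl, rfl, rfl⟩
    refine ⟨⟨rfl, ?_⟩, ?_, ?_⟩
    · linear_combination -B * hp
    · linear_combination -C * hp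
    · linear_combination (q * B * C - D) * hp + q * hdet
end

section
/- Let b ∈ ℂ with b ≠ 0 and set q = −b². Let x, y, z ∈ ℂ and define s₄₅ = x/b − 1, s₂₃ = y/b − 1, s₃₄ = −1 − b·z, and s₂₅ = 1/q − (1 + s₄₅ + s₂₃ + s₂₃·s₄₅). Then s₂₃·s₄₅ = s₃₄·s₂₅ if and only if x·y·z + x + y + z = b − b⁻¹ (the Flaschka–Newell cubic surface equation). -/
/-- with `q = −b²` (`b ≠ 0`), `s₄₅ = x/b − 1`, `s₂₃ = y/b − 1`,
`s₃₄ = −1 − bz` and `s₂₅ = 1/q − (1 + s₄₅ + s₂₃ + s₂₃s₄₅)`, the relation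
`s₂₃s₄₅ = s₃₄s₂₅` holds iff `xyz + x + y + z = b − b⁻¹` (the Flaschka–Newell
cubic surface equation). -/
theorem flaschka_newell_cubic (b x y z q s45 s23 s34 s25 : ℂ) (hb : b ≠ 0)
    (hq : q = -b ^ 2)
    (h45 : s45 = x / b - 1) (h23 : s23 = y / b - 1) (h34 : s34 = -1 - b * z)
    (h25 : s25 = 1 / q - (1 + s45 + s23 + s23 * s45)) :
    s23 * s45 = s34 * s25 ↔ x * y * z + x + y + z = b - b⁻¹ := by
  have key : s23 * s45 - s34 * s25 =
      -b⁻¹ * ((x * y * z + x + y + z) - (b - b⁻¹)) := by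
    subst h25 h34 h23 h45 hq
    field_simp
    ring
  have hb' : -b⁻¹ ≠ 0 := neg_ne_zero.mpr (inv_ne_zero hb)
  rw [← sub_eq_zero, key, mul_eq_zero, or_iff_right hb', sub_eq_zero]
end

section
/- Let k ≥ 1 and let G₁,…,G_{2k} ∈ GL₂(ℂ) (indices modulo 2k) with G_{2i} of the form [[*,0],[*,1]] (in W₋) and G_{2i+1} of the form [[1,*],[0,*]] (in W₊), and with G_{2k}⋯G₂·G₁ = 1. Then there exist c₁,…,c_{2k} ∈ ℂ* such that, defining G'_{2i} = diag(c_{2i+1}, c_{2i})·G_{2i}·diag(c_{2i−1}, c_{2i})⁻¹ and G'_{2i+1} = diag(c_{2i+1}, c_{2i+2})·G_{2i+1}·diag(c_{2i+1}, c_{2i})⁻¹ (indices modulo 2k), each G'ᵢ again lies in W₋ resp. W₊, the matrices G'₂, G'₃, …, G'_{2k−1} are unipotent (their nontrivial diagonal entry equals 1), and G'_{2k}⋯G'₂·G'₁ = 1. -/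
/-- The rescaled matrices: `G'_{2i} = diag(c_{2i+1}, c_{2i})·G_{2i}·diag(c_{2i−1}, c_{2i})⁻¹`
and `G'_{2i+1} = diag(c_{2i+1}, c_{2i+2})·G_{2i+1}·diag(c_{2i+1}, c_{2i})⁻¹`. -/
noncomputable def scaledG (G : ℕ → Matrix (Fin 2) (Fin 2) ℂ) (c : ℕ → ℂ) (i : ℕ) :
    Matrix (Fin 2) (Fin 2) ℂ :=
  if Even i then !![c (i + 1), 0; 0, c i] * G i * (!![c (i - 1), 0; 0, c i])⁻¹
  else !![c i, 0; 0, c (i + 1)] * G i * (!![c i, 0; 0, c (i - 1)])⁻¹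

noncomputable def auxD (G : ℕ → Matrix (Fin 2) (Fin 2) ℂ) : ℕ → ℂ
  | 0 => 1
  | 1 => 1
  | (n + 2) => auxD G n / (G (n + 1)).det

theorem auxD_ne (G : ℕ → Matrix (Fin 2) (Fin 2) ℂ) (hGL : ∀ i, (G i).det ≠ 0) (n : ℕ) :
    auxD G n ≠ 0 ∧ auxD G (n + 1) ≠ 0 := by
  induction n with
  | zero => simp [auxD]
  | succ n ih =>
    refine ⟨ih.2, ?_⟩
    simp only [auxD]
    exact div_ne_zero ih.1 (hGL _)

noncomputable def auxM (c : ℕ → ℂ) (i : ℕ) : Matrix (Fin 2) (Fin 2) ℂ :=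
  if Even i then !![c (i + 1), 0; 0, c i] else !![c i, 0; 0, c (i + 1)]

theorem auxM_det (c : ℕ → ℂ) (hc : ∀ i, c i ≠ 0) (i : ℕ) : IsUnit (auxM c i).det := by
  unfold auxM
  split_ifs <;> simp [Matrix.det_fin_two, hc]

theorem scaledG_succ (G : ℕ → Matrix (Fin 2) (Fin 2) ℂ) (c : ℕ → ℂ) (i : ℕ) :
    scaledG G c (i + 1) = auxM c (i + 1) * G (i + 1) * (auxM c i)⁻¹ := by
  by_cases h : Even i <;> simp [scaledG, auxM, h, Nat.even_add_one]

theorem auxProd (F : ℕ → Matrix (Fin 2) (Fin 2) ℂ) (n : ℕ) :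
    (List.ofFn (fun j : Fin (n + 1) => F (n + 1 - (j : ℕ)))).prod =
      F (n + 1) * (List.ofFn (fun j : Fin n => F (n - (j : ℕ)))).prod := by
  rw [List.ofFn_succ, List.prod_cons]
  simp

theorem aux_tele (G : ℕ → Matrix (Fin 2) (Fin 2) ℂ) (c : ℕ → ℂ) (hc : ∀ i, c i ≠ 0) (n : ℕ) :
    (List.ofFn (fun j : Fin n => scaledG G c (n - (j : ℕ)))).prod =
      auxM c n * (List.ofFn (fun j : Fin n => G (n - (j : ℕ)))).prod * (auxM c 0)⁻¹ := by
  induction n with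
  | zero => simp [Matrix.mul_nonsing_inv _ (auxM_det c hc 0)]
  | succ n ih =>
    rw [auxProd, auxProd, ih, scaledG_succ]
    simp only [Matrix.mul_assoc]
    rw [Matrix.nonsing_inv_mul_cancel_left _ _ (auxM_det c hc n)]

theorem aux_diag_inv (a b : ℂ) (ha : a ≠ 0) (hb : b ≠ 0) :
    (!![a, 0; 0, b])⁻¹ = !![a⁻¹, 0; 0, b⁻¹] := by
  apply Matrix.inv_eq_right_inv
  ext i j
  fin_cases i <;> fin_cases j <;> simp [ha, hb]

/-- given `G₁,…,G_{2k} ∈ GL₂(ℂ)` (extended `2k`-periodically)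
with even-indexed `Gᵢ ∈ W₋ = [[*,0],[*,1]]`, odd-indexed `Gᵢ ∈ W₊ = [[1,*],[0,*]]`
and `G_{2k}⋯G₂G₁ = 1`, there are nonzero scalars `c₁,…,c_{2k}` (extended
periodically), such that the rescaled matrices `G'ᵢ` again lie in `W₋`
resp. `W₊`, the middle ones `G'₂,…,G'_{2k−1}` are unipotent (nontrivial
diagonal entry `1`), and `G'_{2k}⋯G'₂G'₁ = 1`. -/
theorem torus_reduction_to_unipotent (k : ℕ) (hk : 1 ≤ k)
    (G : ℕ → Matrix (Fin 2) (Fin 2) ℂ)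
    (hGper : ∀ i, G (i + 2 * k) = G i)
    (hGL : ∀ i, (G i).det ≠ 0)
    (hGeven : ∀ i, Even i → G i 0 1 = 0 ∧ G i 1 1 = 1)
    (hGodd : ∀ i, Odd i → G i 0 0 = 1 ∧ G i 1 0 = 0)
    (hprod : (List.ofFn (fun j : Fin (2 * k) => G (2 * k - (j : ℕ)))).prod = 1) :
    ∃ c : ℕ → ℂ, (∀ i, c i ≠ 0) ∧ (∀ i, c (i + 2 * k) = c i) ∧
      (∀ i, 1 ≤ i → i ≤ 2 * k →
        (Even i → scaledG G c i 0 1 = 0 ∧ scaledG G c i 1 1 = 1) ∧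
        (Odd i → scaledG G c i 0 0 = 1 ∧ scaledG G c i 1 0 = 0)) ∧
      (∀ i, 2 ≤ i → i ≤ 2 * k - 1 →
        (Even i → scaledG G c i 0 0 = 1) ∧ (Odd i → scaledG G c i 1 1 = 1)) ∧
      (List.ofFn (fun j : Fin (2 * k) => scaledG G c (2 * k - (j : ℕ)))).prod = 1 := by
  have hd : ∀ n, auxD G n ≠ 0 := fun n => (auxD_ne G hGL n).1
  obtain ⟨c, hcdef⟩ : ∃ c : ℕ → ℂ, ∀ i, c i = auxD G ((i + 2 * k - 1) % (2 * k) + 1) :=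
    ⟨_, fun _ => rfl⟩
  have hc : ∀ i, c i ≠ 0 := fun i => by rw [hcdef]; exact hd _
  have hper : ∀ i, c (i + 2 * k) = c i := fun i => by
    rw [hcdef, hcdef, show i + 2 * k + 2 * k - 1 = (i + 2 * k - 1) + 2 * k by omega,
      Nat.add_mod_right]
  have hcd : ∀ i, 1 ≤ i → i ≤ 2 * k → c i = auxD G i := fun i h1 h2 => by
    rw [hcdef, show i + 2 * k - 1 = (i - 1) + 2 * k by omega, Nat.add_mod_right,
      Nat.mod_eq_of_lt (by omega), Nat.sub_add_cancel h1]
  refine ⟨c, hc, hper, ?_, ?_, ?_⟩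
  · intro i h1 h2
    refine ⟨fun he => ?_, fun ho => ?_⟩
    · obtain ⟨h3, h4⟩ := hGeven i he
      simp [scaledG, he, aux_diag_inv _ _ (hc _) (hc _), Matrix.mul_apply, Fin.sum_univ_two, Matrix.vecMul, dotProduct,
        h3, h4, hc]
    · obtain ⟨h3, h4⟩ := hGodd i ho
      simp [scaledG, Nat.not_even_iff_odd.mpr ho, aux_diag_inv _ _ (hc _) (hc _),
        Matrix.mul_apply, Fin.sum_univ_two, Matrix.vecMul, dotProduct, h3, h4, hc]
  · intro i h1 h2
    have key : c (i + 1) * (G i).det * (c (i - 1))⁻¹ = 1 := by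
      rw [hcd (i + 1) (by omega) (by omega), hcd (i - 1) (by omega) (by omega)]
      obtain ⟨n, rfl⟩ : ∃ n, i = n + 1 := ⟨i - 1, by omega⟩
      simp only [auxD, Nat.add_sub_cancel]
      have := hd n
      have := hGL (n + 1)
      field_simp
    refine ⟨fun he => ?_, fun ho => ?_⟩
    · obtain ⟨h3, h4⟩ := hGeven i he
      rw [Matrix.det_fin_two, h3, h4] at key
      simpa [scaledG, he, aux_diag_inv _ _ (hc _) (hc _), Matrix.mul_apply, Fin.sum_univ_two, Matrix.vecMul, dotProduct,
        h3, h4, hc] using key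
    · obtain ⟨h3, h4⟩ := hGodd i ho
      rw [Matrix.det_fin_two, h3, h4] at key
      simpa [scaledG, Nat.not_even_iff_odd.mpr ho, aux_diag_inv _ _ (hc _) (hc _),
        Matrix.mul_apply, Fin.sum_univ_two, Matrix.vecMul, dotProduct, h3, h4, hc] using key
  · rw [aux_tele G c hc, hprod, Matrix.mul_one]
    have : auxM c (2 * k) = auxM c 0 := by
      have a := hper 0
      have b := hper 1
      rw [Nat.zero_add] at a
      rw [Nat.add_comm] at b
      simp [auxM, a, b]
    rw [this, Matrix.mul_nonsing_inv _ (auxM_det c hc 0)]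
end
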